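/- Canonization for products of finite sets (two factors): for all n_0 ≤ l_0 and n_1 ≤ l_1 there exist m_0, m_1 such that for every equivalence relation E on [m_0]^{n_0} × [m_1]^{n_1} there are s_0 ∈ [m_0]^{l_0}, s_1 ∈ [m_1]^{l_1} and sets I_0 ⊆ n_0, I_1 ⊆ n_1 such that for all pairs (b_0,b_1), (c_0,c_1) ∈ [s_0]^{n_0} × [s_1]^{n_1}, (b_0,b_1) E (c_0,c_1) iff b_0 E_{I_0} c_0 and b_1 E_{I_1} c_1. -/

import Mathlib

/-- Finite Ramsey theorem for a single size. -/
theorem ramsey_one (C : Type) [Finite C] (n : ℕ) : ∀ l : ℕ, ∃ m : ℕ, ∀ (A : Finset ℕ), m ≤ A.card →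
    ∀ f : Finset ℕ → C, ∃ S ⊆ A, S.card = l ∧ ∃ c, ∀ x ⊆ S, x.card = n → f x = c := by
  classical
  have := Fintype.ofFinite C
  induction n with
  | zero =>
    intro l
    refine ⟨l, fun A hA f => ?_⟩
    obtain ⟨S, hS, hc⟩ := Finset.exists_subset_card_eq hA
    refine ⟨S, hS, hc, f ∅, fun x _ hx => ?_⟩
    rw [Finset.card_eq_zero.1 hx]
  | succ n ih =>
    have pre : ∀ t : ℕ, ∃ m : ℕ, ∀ (A : Finset ℕ), m ≤ A.card →
        ∀ f : Finset ℕ → C, ∃ S ⊆ A, S.card = t ∧ ∃ g : ℕ → C, ∀ y ∈ S, ∀ x ⊆ S, x.card = n →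
          (∀ w ∈ x, y < w) → f (insert y x) = g y := by
      intro t
      induction t with
      | zero =>
        refine ⟨0, fun A _ f => ⟨∅, by simp, by simp, fun _ => f ∅, by simp⟩⟩
      | succ t iht =>
        obtain ⟨m1, h1⟩ := iht
        obtain ⟨m2, h2⟩ := ih m1
        refine ⟨m2 + 1, fun A hA f => ?_⟩
        have hne : A.Nonempty := Finset.card_pos.1 (by omega)
        set y := A.min' hne with hy
        have hyA : y ∈ A := Finset.min'_mem _ _
        obtain ⟨A', hA', hc', c, hc⟩ := h2 (A.erase y) (by rw [Finset.card_erase_of_mem hyA]; omega)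
          (fun x => f (insert y x))
        obtain ⟨B, hB, hBc, g, hg⟩ := h1 A' hc'.ge f
        have hlt : ∀ w ∈ B, y < w := by
          intro w hw
          have := hA' (hB hw)
          rw [Finset.mem_erase] at this
          exact lt_of_le_of_ne (Finset.min'_le _ _ this.2) (Ne.symm this.1)
        have hyB : y ∉ B := fun h => lt_irrefl _ (hlt y h)
        refine ⟨insert y B, ?_, by rw [Finset.card_insert_of_notMem hyB, hBc],
          Function.update g y c, ?_⟩
        · intro w hw
          rcases Finset.mem_insert.1 hw with rfl | h
          · exact hyA
          · exact Finset.mem_of_mem_erase (hA' (hB h))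
        · intro z hz x hx hxc hzx
          have hxB : x ⊆ B := by
            intro w hw
            rcases Finset.mem_insert.1 (hx hw) with h | h
            · have := hzx w hw
              rcases Finset.mem_insert.1 hz with h' | h'
              · omega
              · have := hlt z h'; omega
            · exact h
          rcases Finset.mem_insert.1 hz with h | h
          · rw [h]
            simp only [Function.update_self]
            exact hc x (hxB.trans hB) hxc
          · have := hlt z h
            rw [Function.update_of_ne (by omega)]
            exact hg z h x hxB hxc hzx
    intro l
    obtain ⟨m, hm⟩ := pre (Fintype.card C * l)
    refine ⟨m, fun A hA f => ?_⟩
    obtain ⟨B, hB, hBc, g, hg⟩ := hm A hA f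
    obtain ⟨c, -, hc⟩ := Finset.exists_le_card_fiber_of_mul_le_card_of_maps_to
      (s := B) (t := (Finset.univ : Finset C)) (f := g) (n := l) (fun _ _ => Finset.mem_univ _)
      ⟨f ∅, Finset.mem_univ _⟩ (by rw [hBc]; simp)
    obtain ⟨S, hS, hSc⟩ := Finset.exists_subset_card_eq hc
    refine ⟨S, fun w hw => hB (Finset.mem_filter.1 (hS hw)).1, hSc, c, fun x hx hxc => ?_⟩
    have hne : x.Nonempty := Finset.card_pos.1 (by omega)
    have hmem := Finset.min'_mem x hne
    have h1 := Finset.mem_filter.1 (hS (hx hmem))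
    rw [← Finset.insert_erase hmem, hg _ h1.1 (x.erase (x.min' hne)), h1.2]
    · intro w hw
      exact (Finset.mem_filter.1 (hS (hx (Finset.mem_of_mem_erase hw)))).1
    · rw [Finset.card_erase_of_mem hmem]; omega
    · intro w hw
      exact Finset.min'_lt_of_mem_erase_min' x hne hw

/-- Ramsey for all sizes below `N` simultaneously. -/
theorem ramsey_all (C : Type) [Finite C] (N : ℕ) : ∀ l : ℕ, ∃ m : ℕ, ∀ (A : Finset ℕ), m ≤ A.card →
    ∀ f : Finset ℕ → C, ∃ S ⊆ A, S.card = l ∧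
      ∀ x ⊆ S, ∀ y ⊆ S, x.card < N → x.card = y.card → f x = f y := by
  induction N with
  | zero =>
    intro l
    refine ⟨l, fun A hA f => ?_⟩
    obtain ⟨S, hS, hc⟩ := Finset.exists_subset_card_eq hA
    exact ⟨S, hS, hc, fun x _ y _ h => by omega⟩
  | succ N ih =>
    intro l
    obtain ⟨m1, h1⟩ := ih l
    obtain ⟨m2, h2⟩ := ramsey_one C N m1
    refine ⟨m2, fun A hA f => ?_⟩
    obtain ⟨B, hB, hBc, c, hc⟩ := h2 A hA f
    obtain ⟨S, hS, hSc, h⟩ := h1 B hBc.ge f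
    refine ⟨S, hS.trans hB, hSc, fun x hx y hy hN hxy => ?_⟩
    rcases Nat.lt_succ_iff_lt_or_eq.1 hN with h' | h'
    · exact h x hx y hy h' hxy
    · rw [hc x (hx.trans hS) h', hc y (hy.trans hS) (by omega)]

/-- Product Ramsey. -/
theorem ramsey_prod (C : Type) [Finite C] (N0 N1 l0 l1 : ℕ) : ∃ m0 m1 : ℕ,
    ∀ f : Finset ℕ → Finset ℕ → C, ∃ S0 ⊆ Finset.range m0, ∃ S1 ⊆ Finset.range m1,
      S0.card = l0 ∧ S1.card = l1 ∧
      ∀ x ⊆ S0, ∀ x' ⊆ S0, x.card < N0 → x.card = x'.card →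
      ∀ y ⊆ S1, ∀ y' ⊆ S1, y.card < N1 → y.card = y'.card → f x y = f x' y' := by
  classical
  obtain ⟨m0, h0⟩ := ramsey_all (Fin N1 → C) N0 l0
  obtain ⟨m1, h1⟩ := ramsey_all ({x : Finset ℕ // x ∈ (Finset.range m0).powerset} → C) N1 l1
  refine ⟨m0, m1, fun f => ?_⟩
  obtain ⟨S1, hS1, hc1, k1⟩ := h1 (Finset.range m1) (by simp) (fun y x => f x.1 y)
  have hrep : ∀ k : ℕ, ∃ r : Finset ℕ, ∀ y ⊆ S1, y.card = k → (r ⊆ S1 ∧ r.card = k) := by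
    intro k
    by_cases h : ∃ y ⊆ S1, y.card = k
    · obtain ⟨y, hy⟩ := h
      exact ⟨y, fun _ _ _ => hy⟩
    · exact ⟨∅, fun y hy hk => (h ⟨y, hy, hk⟩).elim⟩
  choose r hr using hrep
  obtain ⟨S0, hS0, hc0, k0⟩ := h0 (Finset.range m0) (by simp) (fun x k => f x (r k))
  refine ⟨S0, hS0, S1, hS1, hc0, hc1, fun x hx x' hx' hN hxx y hy y' hy' hM hyy => ?_⟩
  have e0 : ∀ x ⊆ S0, ∀ y ⊆ S1, y.card < N1 → f x y = f x (r y.card) := by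
    intro x hx y hy hM
    have h := hr y.card y hy rfl
    have := k1 y hy (r y.card) h.1 hM h.2.symm
    exact congrFun this ⟨x, Finset.mem_powerset.2 (hx.trans hS0)⟩
  rw [e0 x hx y hy hM, e0 x' hx' y' hy' (hyy ▸ hM), ← hyy]
  exact congrFun (k0 x hx x' hx' hN hxx) ⟨y.card, hM⟩

/-- Enumeration of a finite set, with junk value. -/
noncomputable def enumSet (N : ℕ) (X : Finset ℕ) (k : Fin N) : ℕ :=
  if h : k.1 < X.card then X.orderEmbOfFin rfl ⟨k.1, h⟩ else 0

theorem enumSet_image (N : ℕ) (A : Finset ℕ) (hA : A.card ≤ N) (φ : ℕ → ℕ)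
    (hφ : StrictMonoOn φ (A : Set ℕ)) (a : ℕ) (ha : a ∈ A) :
    ∃ k : Fin N, enumSet N A k = a ∧ enumSet N (A.image φ) k = φ a := by
  have hc : (A.image φ).card = A.card := Finset.card_image_of_injOn hφ.injOn
  have : a ∈ Set.range (A.orderEmbOfFin rfl) := by rw [Finset.range_orderEmbOfFin]; exact ha
  obtain ⟨i, hi⟩ := this
  refine ⟨⟨i.1, by omega⟩, ?_, ?_⟩
  · simp [enumSet, hi]
  · have h2 : i.1 < (A.image φ).card := by omega
    have hu := Finset.orderEmbOfFin_unique (s := A.image φ) hc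
      (f := fun i => φ (A.orderEmbOfFin rfl i))
      (fun x => Finset.mem_image_of_mem _ (Finset.orderEmbOfFin_mem _ _ _))
      (fun x y hxy => hφ (Finset.orderEmbOfFin_mem _ _ _) (Finset.orderEmbOfFin_mem _ _ _)
        ((A.orderEmbOfFin rfl).strictMono hxy))
    have := congrFun hu i
    simp only [enumSet, h2, dif_pos]
    rw [← hi, this]
    exact Finset.orderEmbOfFin_eq_orderEmbOfFin_iff.2 rfl

/-- strictly increasing tuples with values in `S`. -/
def Tup (n : ℕ) (S : Finset ℕ) (b : Fin n → ℕ) : Prop := StrictMono b ∧ ∀ i, b i ∈ S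

/-- Homogeneity from product Ramsey. -/
theorem homog (n0 n1 L0 L1 : ℕ) : ∃ m0 m1 : ℕ,
    ∀ R : (Fin n0 → ℕ) → (Fin n1 → ℕ) → (Fin n0 → ℕ) → (Fin n1 → ℕ) → Prop,
    ∃ S0 ⊆ Finset.range m0, ∃ S1 ⊆ Finset.range m1, S0.card = L0 ∧ S1.card = L1 ∧
      ∀ b c : Fin n0 → ℕ, ∀ x y : Fin n1 → ℕ, ∀ φ ψ : ℕ → ℕ,
        (∀ i, b i ∈ S0) → (∀ i, c i ∈ S0) → (∀ i, x i ∈ S1) → (∀ i, y i ∈ S1) →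
        (∀ i, φ (b i) ∈ S0) → (∀ i, φ (c i) ∈ S0) → (∀ i, ψ (x i) ∈ S1) → (∀ i, ψ (y i) ∈ S1) →
        StrictMonoOn φ (Set.range b ∪ Set.range c) →
        StrictMonoOn ψ (Set.range x ∪ Set.range y) →
        (R b x c y ↔ R (φ ∘ b) (ψ ∘ x) (φ ∘ c) (ψ ∘ y)) := by
  classical
  set N0 := n0 + n0 + 1 with hN0
  set N1 := n1 + n1 + 1 with hN1
  have hfp : Finite Prop := Finite.of_fintype Prop
  have hf4 : Finite ((Fin n1 → Fin N1) → Prop) := Pi.finite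
  have hf3 : Finite ((Fin n0 → Fin N0) → (Fin n1 → Fin N1) → Prop) := Pi.finite
  have hf2 : Finite ((Fin n1 → Fin N1) → (Fin n0 → Fin N0) → (Fin n1 → Fin N1) → Prop) := Pi.finite
  have hf1 : Finite ((Fin n0 → Fin N0) → (Fin n1 → Fin N1) → (Fin n0 → Fin N0) →
    (Fin n1 → Fin N1) → Prop) := Pi.finite
  obtain ⟨m0, m1, hm⟩ := ramsey_prod
    ((Fin n0 → Fin N0) → (Fin n1 → Fin N1) → (Fin n0 → Fin N0) → (Fin n1 → Fin N1) → Prop)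
    N0 N1 L0 L1
  refine ⟨m0, m1, fun R => ?_⟩
  obtain ⟨S0, hS0, S1, hS1, hc0, hc1, h⟩ := hm (fun X Y F G F' G' =>
    R (enumSet N0 X ∘ F) (enumSet N1 Y ∘ G) (enumSet N0 X ∘ F') (enumSet N1 Y ∘ G'))
  refine ⟨S0, hS0, S1, hS1, hc0, hc1, ?_⟩
  intro b c x y φ ψ hb hc hx hy hφb hφc hψx hψy hφ hψ
  have aux : ∀ {n : ℕ} (b c : Fin n → ℕ) (φ : ℕ → ℕ) (S : Finset ℕ),
      (∀ i, b i ∈ S) → (∀ i, c i ∈ S) → (∀ i, φ (b i) ∈ S) → (∀ i, φ (c i) ∈ S) →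
      StrictMonoOn φ (Set.range b ∪ Set.range c) →
      ∃ A ⊆ S, A.image φ ⊆ S ∧ A.card < n + n + 1 ∧ A.card = (A.image φ).card ∧
      ∃ F F' : Fin n → Fin (n + n + 1),
        enumSet _ A ∘ F = b ∧ enumSet _ A ∘ F' = c ∧
        enumSet _ (A.image φ) ∘ F = φ ∘ b ∧ enumSet _ (A.image φ) ∘ F' = φ ∘ c := by
    intro n b c φ S hb hc hφb hφc hφ
    have hcard : (Finset.univ.image b ∪ Finset.univ.image c).card ≤ n + n := by
      refine (Finset.card_union_le _ _).trans (Nat.add_le_add ?_ ?_)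
      · exact Finset.card_image_le.trans (by simp)
      · exact Finset.card_image_le.trans (by simp)
    have hφ' : StrictMonoOn φ
        ((Finset.univ.image b ∪ Finset.univ.image c : Finset ℕ) : Set ℕ) := by
      simpa using hφ
    have hk := enumSet_image (n + n + 1) _ (by omega) φ hφ'
    have h1 := fun i => hk (b i) (by simp)
    have h2 := fun i => hk (c i) (by simp)
    choose F hF using h1
    choose F' hF' using h2
    refine ⟨_, ?_, ?_, Nat.lt_succ_of_le hcard, (Finset.card_image_of_injOn hφ'.injOn).symm,
      F, F', funext fun i => (hF i).1, funext fun i => (hF' i).1,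
      funext fun i => (hF i).2, funext fun i => (hF' i).2⟩
    · intro w hw
      simp only [Finset.mem_union, Finset.mem_image, Finset.mem_univ, true_and] at hw
      rcases hw with ⟨i, rfl⟩ | ⟨i, rfl⟩
      · exact hb i
      · exact hc i
    · intro w hw
      simp only [Finset.mem_union, Finset.mem_image, Finset.mem_univ, true_and] at hw
      rcases hw with ⟨_, ⟨i, rfl⟩ | ⟨i, rfl⟩, rfl⟩
      · exact hφb i
      · exact hφc i
  obtain ⟨A, hA, hA', hAc, hAe, F, F', f1, f2, f3, f4⟩ := aux b c φ S0 hb hc hφb hφc hφ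
  obtain ⟨B, hB, hB', hBc, hBe, G, G', g1, g2, g3, g4⟩ := aux x y ψ S1 hx hy hψx hψy hψ
  have this : R (enumSet (n0 + n0 + 1) A ∘ F) (enumSet (n1 + n1 + 1) B ∘ G)
      (enumSet (n0 + n0 + 1) A ∘ F') (enumSet (n1 + n1 + 1) B ∘ G') =
      R (enumSet (n0 + n0 + 1) (A.image φ) ∘ F) (enumSet (n1 + n1 + 1) (B.image ψ) ∘ G)
      (enumSet (n0 + n0 + 1) (A.image φ) ∘ F') (enumSet (n1 + n1 + 1) (B.image ψ) ∘ G') :=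
    congrFun (congrFun (congrFun (congrFun
    (h A hA _ hA' hAc hAe B hB _ hB' hBc hBe) F) G) F') G'
  rw [f1, f2, f3, f4, g1, g2, g3, g4] at this
  exact iff_of_eq this

/-- The one-sided core. -/
theorem core {X : Type} (V : X → Prop) (n : ℕ) (S T : Finset ℕ) (hTS : T ⊆ S)
    (hgap : ∀ p ∈ T, ∃ q ∈ S, ∃ r ∈ S, p < q ∧ q < r ∧ ∀ t ∈ T, p < t → r < t)
    (R : (Fin n → ℕ) → X → (Fin n → ℕ) → X → Prop)
    (hrefl : ∀ b x, Tup n S b → V x → R b x b x)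
    (hsymm : ∀ b x c y, R b x c y → R c y b x)
    (htrans : ∀ b x c y d z, R b x c y → R c y d z → R b x d z)
    (hmove : ∀ b c x y (φ : ℕ → ℕ), Tup n S b → Tup n S c → V x → V y →
      (∀ i, φ (b i) ∈ S) → (∀ i, φ (c i) ∈ S) →
      StrictMonoOn φ (Set.range b ∪ Set.range c) → (R b x c y ↔ R (φ ∘ b) x (φ ∘ c) y))
    (hU : ∀ b c x y, Tup n S b → Tup n S c → V x → V y → (R b x c x ↔ R b y c y)) :
    ∃ I : Set (Fin n),
      (∀ b c x y, Tup n T b → Tup n T c → V x → V y → R b x c y → ∀ i ∈ I, b i = c i) ∧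
      (∀ b c x, Tup n S b → Tup n S c → V x → (∀ i ∈ I, b i = c i) → R b x c x) := by
  classical
  have up : ∀ b d x y i p p', Tup n S b → Tup n S d → V x → V y → b i < p → d i < p' →
      Tup n S (Function.update b i p) → Tup n S (Function.update d i p') →
      R b x (Function.update b i p) x → R d y (Function.update d i p') y := by
    intro b d x y i p p' hb hd hx hy hp hp' hb' hd' h
    have hu : ∀ {b : Fin n → ℕ} {p}, Tup n S (Function.update b i p) → ∀ j, i < j → p < b j := by
      intro b p hb j hj
      have := hb.1 hj
      rwa [Function.update_self, Function.update_of_ne hj.ne'] at this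
    have hpn : ¬ ∃ j, b j = p := by
      rintro ⟨j, hj⟩
      rcases lt_trichotomy j i with hji | rfl | hji
      · have := hb.1 hji; omega
      · omega
      · have := hu hb' j hji; omega
    set φ : ℕ → ℕ := Function.extend b d (fun _ => p') with hφdef
    have e1 : ∀ j, φ (b j) = d j := fun j => hb.1.injective.extend_apply _ _ _
    have e2 : φ p = p' := Function.extend_apply' _ _ _ hpn
    have e3 : φ ∘ b = d := funext e1
    have e4 : φ ∘ (Function.update b i p) = Function.update d i p' := by
      funext j
      by_cases hj : j = i
      · subst hj; simp [e2]
      · simp [hj, e1]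
    have hm := hmove b (Function.update b i p) x x φ hb hb' hx hx (fun j => by rw [e1]; exact hd.2 j)
      (fun j => by have := congrFun e4 j; simp only [Function.comp] at this; rw [this]; exact hd'.2 j)
      (by
        have hsub : Set.range b ∪ Set.range (Function.update b i p) ⊆ insert p (Set.range b) := by
          rintro w (hw | ⟨j, rfl⟩)
          · exact Or.inr hw
          · by_cases hj : j = i
            · subst hj; simp
            · simp [hj]
        refine StrictMonoOn.mono ?_ hsub
        rintro u (rfl | ⟨j, rfl⟩) v (rfl | ⟨k, rfl⟩) huv
        · omega
        · rw [e2, e1]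
          refine hu hd' k ?_
          by_contra hk
          have := hb.1.monotone (not_lt.1 hk); omega
        · rw [e2, e1]
          have : j ≤ i := by
            by_contra hk
            have := hu hb' j (not_le.1 hk); omega
          have := hd.1.monotone this; omega
        · rw [e1, e1]
          exact hd.1 (hb.1.lt_iff_lt.1 huv))
    rw [e3, e4] at hm
    exact (hU _ _ x y hd hd' hx hy).1 (hm.1 h)
  set I : Set (Fin n) := {i | ∃ b p x, Tup n S b ∧ Tup n S (Function.update b i p) ∧ V x ∧ b i < p ∧
    ¬ R b x (Function.update b i p) x} with hI
  have hIn : ∀ i ∈ I, ∀ b p x, Tup n S b → Tup n S (Function.update b i p) → V x → b i < p →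
      ¬ R b x (Function.update b i p) x := by
    rintro i ⟨d, p', y, hd, hd', hy, hlt', hR'⟩ b p x hb hb' hx hlt hR
    exact hR' (up b d x y i p p' hb hd hx hy hlt hlt' hb' hd' hR)
  have hOut : ∀ i, i ∉ I → ∀ b p x, Tup n S b → Tup n S (Function.update b i p) → V x → b i < p →
      R b x (Function.update b i p) x := by
    intro i hi b p x hb hb' hx hlt
    by_contra hR
    exact hi ⟨b, p, x, hb, hb', hx, hlt, hR⟩
  refine ⟨I, ?_, ?_⟩
  · -- first part
    have updTup : ∀ (b : Fin n → ℕ) i q, Tup n S b → q ∈ S → b i < q →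
        (∀ j, b i < b j → q < b j) → Tup n S (Function.update b i q) := by
      intro b i q hb hq hlt hj
      constructor
      · intro j k hjk
        by_cases h1 : j = i
        · subst h1
          rw [Function.update_self, Function.update_of_ne hjk.ne']
          exact hj k (hb.1 hjk)
        · rw [Function.update_of_ne h1]
          by_cases h2 : k = i
          · subst h2
            rw [Function.update_self]
            exact (hb.1 hjk).trans hlt
          · rw [Function.update_of_ne h2]
            exact hb.1 hjk
      · intro j
        by_cases h1 : j = i
        · subst h1; simpa using hq
        · rw [Function.update_of_ne h1]; exact hb.2 j
    have sep : ∀ b c x y i q, i ∈ I → Tup n S b → Tup n S c → V x → V y → q ∈ S → b i < q →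
        (∀ j, b i < b j → q < b j) → (∀ j, b i < c j → q < c j) → (∀ j, c j ≠ b i) →
        ¬ R b x c y := by
      intro b c x y i q hi hb hc hx hy hq hlt hbj hcj hne hR
      have hb' := updTup b i q hb hq hlt hbj
      set φ : ℕ → ℕ := fun w => if w = b i then q else w with hφ
      have e1 : φ ∘ b = Function.update b i q := by
        funext j
        by_cases hj : j = i
        · subst hj; simp [hφ]
        · simp [hφ, hj, hb.1.injective.eq_iff]
      have e2 : φ ∘ c = c := by
        funext j
        simp [hφ, hne j]
      have hm := hmove b c x y φ hb hc hx hy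
        (fun j => by have := congrFun e1 j; simp only [Function.comp] at this; rw [this]; exact hb'.2 j)
        (fun j => by have := congrFun e2 j; simp only [Function.comp] at this; rw [this]; exact hc.2 j)
        (by
          have hall : ∀ w ∈ Set.range b ∪ Set.range c, b i < w → q < w := by
            rintro w (⟨j, rfl⟩ | ⟨j, rfl⟩)
            · exact hbj j
            · exact hcj j
          intro u hu v hv huv
          have h1 := hall u hu
          have h2 := hall v hv
          simp only [hφ]
          split_ifs <;> grind)
      rw [e1, e2] at hm
      exact hIn i hi b q x hb hb' hx hlt (htrans _ _ _ _ _ _ hR (hsymm _ _ _ _ (hm.1 hR)))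
    have sub : ∀ b c x y, Tup n T b → Tup n T c → V x → V y → R b x c y →
        ∀ i ∈ I, ∃ j ∈ I, c j = b i := by
      intro b c x y hb hc hx hy hR i hi
      obtain ⟨q, hq, r, hr, hpq, hqr, hgap'⟩ := hgap (b i) (hb.2 i)
      have hbS : Tup n S b := ⟨hb.1, fun j => hTS (hb.2 j)⟩
      have hcS : Tup n S c := ⟨hc.1, fun j => hTS (hc.2 j)⟩
      have hbj : ∀ j, b i < b j → q < b j := fun j h => hqr.trans (hgap' _ (hb.2 j) h)
      have hcj : ∀ j, b i < c j → q < c j := fun j h => hqr.trans (hgap' _ (hc.2 j) h)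
      by_contra hcon
      push Not at hcon
      by_cases hex : ∃ j, c j = b i
      · obtain ⟨j, hj⟩ := hex
        have hjI : j ∉ I := fun h => hcon j h hj
        have hc' : Tup n S (Function.update c j r) :=
          updTup c j r hcS hr (by omega) (fun k hk => hgap' _ (hc.2 k) (by omega))
        have hR2 := hOut j hjI c r y hcS hc' hy (by omega)
        refine sep b (Function.update c j r) x y i q hi hbS hc' hx hy hq hpq hbj ?_ ?_
          (htrans _ _ _ _ _ _ hR hR2)
        · intro k hk
          by_cases h : k = j
          · subst h; simpa using hqr
          · rw [Function.update_of_ne h] at hk ⊢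
            exact hcj k hk
        · intro k
          by_cases h : k = j
          · subst h; rw [Function.update_self]; omega
          · rw [Function.update_of_ne h, ← hj]
            exact fun h' => h (hc.1.injective h')
      · push Not at hex
        exact sep b c x y i q hi hbS hcS hx hy hq hpq hbj hcj hex hR
    intro b c x y hb hc hx hy hR i hi
    have hrange : Set.range (fun i : I => b i) = Set.range (fun i : I => c i) := by
      ext w
      constructor
      · rintro ⟨⟨k, hk⟩, rfl⟩
        obtain ⟨j, hj, he⟩ := sub b c x y hb hc hx hy hR k hk
        exact ⟨⟨j, hj⟩, he⟩
      · rintro ⟨⟨k, hk⟩, rfl⟩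
        obtain ⟨j, hj, he⟩ := sub c b y x hc hb hy hx (hsymm _ _ _ _ hR) k hk
        exact ⟨⟨j, hj⟩, he⟩
    have hs1 : StrictMono (fun i : I => b i) := fun u v huv => hb.1 huv
    have hs2 : StrictMono (fun i : I => c i) := fun u v huv => hc.1 huv
    exact congrFun ((StrictMono.range_inj hs1 hs2).1 hrange) ⟨i, hi⟩
  · -- second part
    have mono : ∀ b c x, Tup n S b → Tup n S c → V x → (∀ i ∈ I, b i = c i) → (∀ i, b i ≤ c i) →
        R b x c x := by
      intro b c x hb hc hx hag hle
      let d : ℕ → Fin n → ℕ := fun k i => if i.1 < k then b i else c i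
      have hd : ∀ k, Tup n S (d k) := by
        intro k
        constructor
        · intro i j hij
          have h1 := hb.1 hij
          have h2 := hc.1 hij
          have h3 := hle j
          have h4 : i.1 < j.1 := hij
          simp only [d]
          split_ifs <;> omega
        · intro i
          simp only [d]
          split_ifs
          · exact hb.2 i
          · exact hc.2 i
      have step : ∀ k ≤ n, R (d k) x c x := by
        intro k
        induction k with
        | zero =>
          intro _
          have : d 0 = c := by funext i; simp [d]
          rw [this]; exact hrefl c x hc hx
        | succ k ih =>
          intro hk
          refine htrans _ _ _ _ _ _ ?_ (ih (by omega))
          let i : Fin n := ⟨k, by omega⟩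
          have he : d k = Function.update (d (k+1)) i (c i) := by
            funext j
            by_cases hj : j = i
            · subst hj; simp [d, i]
            · have : j.1 ≠ k := fun h => hj (Fin.ext h)
              rw [Function.update_of_ne hj]
              simp only [d]
              split_ifs <;> first | rfl | omega
          have hdi : d (k+1) i = b i := by simp [d, i]
          rcases (hle i).eq_or_lt with h | h
          · have : d k = d (k+1) := by
              rw [he, ← h, ← hdi, Function.update_eq_self]
            rw [this]; exact hrefl _ x (hd _) hx
          · have hi : i ∉ I := fun hi => h.ne (hag i hi)
            have hT := hd k
            rw [he] at hT ⊢
            exact hOut i hi _ _ x (hd _) hT hx (by rw [hdi]; exact h)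
      have hn := step n le_rfl
      have : d n = b := by funext i; simp [d]
      rwa [this] at hn
    intro b c x hb hc hx hag
    have he : Tup n S (fun i => max (b i) (c i)) := by
      constructor
      · intro i j hij
        exact max_lt_max (hb.1 hij) (hc.1 hij)
      · intro i
        rcases max_choice (b i) (c i) with h | h
        · simp only [h]; exact hb.2 i
        · simp only [h]; exact hc.2 i
    refine htrans _ _ _ _ _ _ (mono b _ x hb he hx (fun i hi => ?_) (fun i => le_max_left _ _))
      (hsymm _ _ _ _ (mono c _ x hc he hx (fun i hi => ?_) (fun i => le_max_right _ _)))
    · simp [hag i hi]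
    · simp [hag i hi]

theorem exists_gap (l : ℕ) (S : Finset ℕ) (hS : S.card = 3 * l) : ∃ T ⊆ S, T.card = l ∧
    ∀ p ∈ T, ∃ q ∈ S, ∃ r ∈ S, p < q ∧ q < r ∧ ∀ t ∈ T, p < t → r < t := by
  classical
  let e := S.orderEmbOfFin hS
  let g : Fin l → ℕ := fun i => e ⟨3 * i.1, by omega⟩
  have hg : StrictMono g := fun i j hij => e.strictMono (by
    have : i.1 < j.1 := hij
    simp only [Fin.mk_lt_mk]; omega)
  refine ⟨Finset.univ.image g, ?_, ?_, ?_⟩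
  · intro w hw
    obtain ⟨i, -, rfl⟩ := Finset.mem_image.1 hw
    exact Finset.orderEmbOfFin_mem _ _ _
  · rw [Finset.card_image_of_injective _ hg.injective]; simp
  · intro p hp
    obtain ⟨i, -, rfl⟩ := Finset.mem_image.1 hp
    refine ⟨e ⟨3 * i.1 + 1, by omega⟩, Finset.orderEmbOfFin_mem _ _ _,
      e ⟨3 * i.1 + 2, by omega⟩, Finset.orderEmbOfFin_mem _ _ _, ?_, ?_, ?_⟩
    · exact e.strictMono (by simp only [Fin.mk_lt_mk]; omega)
    · exact e.strictMono (by simp only [Fin.mk_lt_mk]; omega)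
    · intro t ht hlt
      obtain ⟨j, -, rfl⟩ := Finset.mem_image.1 ht
      have : i.1 < j.1 := hg.lt_iff_lt.1 hlt
      exact e.strictMono (by simp only [Fin.mk_lt_mk]; omega)

/-- the increasing tuple of naturals of an `n`-subset of `Fin m`. -/
def tupOf {m n : ℕ} (t : {t : Finset (Fin m) // t.card = n}) (i : Fin n) : ℕ :=
  (t.1.orderEmbOfFin t.2 i).1

theorem tupOf_injective {m n : ℕ} : Function.Injective (tupOf (m := m) (n := n)) := by
  rintro ⟨s, hs⟩ ⟨t, ht⟩ h
  apply Subtype.ext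
  have h1 : (s.orderEmbOfFin hs : Fin n → Fin m) = t.orderEmbOfFin ht :=
    funext fun i => Fin.ext (congrFun h i)
  have h2 := Finset.range_orderEmbOfFin s hs
  rw [h1, Finset.range_orderEmbOfFin t ht] at h2
  exact (Finset.coe_injective h2).symm

theorem tupOf_strictMono {m n : ℕ} (t : {t : Finset (Fin m) // t.card = n}) :
    StrictMono (tupOf t) := fun _ _ hij => (t.1.orderEmbOfFin t.2).strictMono hij

theorem exists_tupOf {m n : ℕ} (S : Finset ℕ) (hS : S ⊆ Finset.range m) (b : Fin n → ℕ)
    (hb : Tup n S b) : ∃ t : {t : Finset (Fin m) // t.card = n}, tupOf t = b := by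
  classical
  let g : Fin n → Fin m := fun i => ⟨b i, Finset.mem_range.1 (hS (hb.2 i))⟩
  have hg : StrictMono g := fun i j hij => hb.1 hij
  have hc : (Finset.univ.image g).card = n := by
    rw [Finset.card_image_of_injective _ hg.injective]; simp
  refine ⟨⟨Finset.univ.image g, hc⟩, ?_⟩
  have := Finset.orderEmbOfFin_unique hc (f := g) (fun x => by simp) hg
  funext i
  simp only [tupOf, ← this]
  rfl

theorem exists_trans {n : ℕ} (S : Finset ℕ) (x y : Fin n → ℕ) (hx : Tup n S x) (hy : Tup n S y) :
    ∃ ψ : ℕ → ℕ, ψ ∘ x = y ∧ StrictMonoOn ψ (Set.range x) := by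
  have e1 : ∀ j, Function.extend x y (fun _ => 0) (x j) = y j :=
    fun j => hx.1.injective.extend_apply _ _ _
  refine ⟨Function.extend x y (fun _ => 0), funext e1, ?_⟩
  rintro _ ⟨i, rfl⟩ _ ⟨j, rfl⟩ hij
  rw [e1, e1]
  exact hy.1 (hx.1.lt_iff_lt.1 hij)

theorem card_lift {m : ℕ} (T : Finset ℕ) (hT : T ⊆ Finset.range m) :
    (Finset.univ.filter (fun i : Fin m => i.1 ∈ T)).card = T.card := by
  classical
  rw [← Finset.card_map Fin.valEmbedding]
  congr 1
  ext w
  simp only [Finset.mem_map, Finset.mem_filter, Finset.mem_univ, true_and, Fin.valEmbedding_apply]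
  constructor
  · rintro ⟨a, ha, rfl⟩; exact ha
  · intro hw; exact ⟨⟨w, Finset.mem_range.1 (hT hw)⟩, hw, rfl⟩


/-- Canonization for products of finite sets, two factors: for all
`n0 ≤ l0` and `n1 ≤ l1` there are `m0, m1` such that every equivalence relation on
`[m0]^{n0} × [m1]^{n1}` is, when restricted to `[s0]^{n0} × [s1]^{n1}` for suitable
`s0 ∈ [m0]^{l0}`, `s1 ∈ [m1]^{l1}`, given coordinatewise by canonical relations
`E_{I0}` and `E_{I1}`. -/
theorem stmt_14 (n0 l0 n1 l1 : ℕ) (h0 : n0 ≤ l0) (h1 : n1 ≤ l1) :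
    ∃ m0 m1 : ℕ,
      ∀ E : ({t : Finset (Fin m0) // t.card = n0} × {t : Finset (Fin m1) // t.card = n1}) →
            ({t : Finset (Fin m0) // t.card = n0} × {t : Finset (Fin m1) // t.card = n1}) →
            Prop,
        Equivalence E →
        ∃ s0 : Finset (Fin m0), s0.card = l0 ∧
          ∃ s1 : Finset (Fin m1), s1.card = l1 ∧
            ∃ (I0 : Set (Fin n0)) (I1 : Set (Fin n1)),
              ∀ b c : {t : Finset (Fin m0) // t.card = n0} ×
                      {t : Finset (Fin m1) // t.card = n1},
                b.1.1 ⊆ s0 → b.2.1 ⊆ s1 → c.1.1 ⊆ s0 → c.2.1 ⊆ s1 →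
                (E b c ↔
                  ((∀ i ∈ I0, b.1.1.orderEmbOfFin b.1.2 i = c.1.1.orderEmbOfFin c.1.2 i) ∧
                   (∀ i ∈ I1, b.2.1.orderEmbOfFin b.2.2 i = c.2.1.orderEmbOfFin c.2.2 i))) := by
  classical
  obtain ⟨m0, m1, hm⟩ := homog n0 n1 (3 * l0) (3 * l1)
  refine ⟨m0, m1, fun E hE => ?_⟩
  let R : (Fin n0 → ℕ) → (Fin n1 → ℕ) → (Fin n0 → ℕ) → (Fin n1 → ℕ) → Prop :=
    fun b x c y => ∃ β γ, tupOf β.1 = b ∧ tupOf β.2 = x ∧ tupOf γ.1 = c ∧ tupOf γ.2 = y ∧ E β γ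
  have hRE : ∀ β γ, R (tupOf β.1) (tupOf β.2) (tupOf γ.1) (tupOf γ.2) ↔ E β γ := by
    intro β γ
    constructor
    · rintro ⟨β', γ', a1, a2, a3, a4, h⟩
      have e1 : β' = β := Prod.ext (tupOf_injective a1) (tupOf_injective a2)
      have e2 : γ' = γ := Prod.ext (tupOf_injective a3) (tupOf_injective a4)
      rwa [e1, e2] at h
    · intro h
      exact ⟨β, γ, rfl, rfl, rfl, rfl, h⟩
  obtain ⟨S0, hS0, S1, hS1, hc0, hc1, hom⟩ := hm R
  have hrefl : ∀ b x, Tup n0 S0 b → Tup n1 S1 x → R b x b x := by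
    intro b x hb hx
    obtain ⟨s, rfl⟩ := exists_tupOf S0 hS0 b hb
    obtain ⟨t, rfl⟩ := exists_tupOf S1 hS1 x hx
    exact (hRE (s, t) (s, t)).2 (hE.refl _)
  have hsymm : ∀ b x c y, R b x c y → R c y b x := by
    rintro b x c y ⟨β, γ, a1, a2, a3, a4, h⟩
    exact ⟨γ, β, a3, a4, a1, a2, hE.symm h⟩
  have htrans : ∀ b x c y d z, R b x c y → R c y d z → R b x d z := by
    rintro b x c y d z ⟨β, γ, a1, a2, rfl, rfl, h⟩ ⟨γ', δ, b1, b2, b3, b4, h'⟩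
    have e : γ' = γ := Prod.ext (tupOf_injective b1) (tupOf_injective b2)
    rw [e] at h'
    exact ⟨β, δ, a1, a2, b3, b4, hE.trans h h'⟩
  obtain ⟨T0, hT0, hk0, gap0⟩ := exists_gap l0 S0 hc0
  obtain ⟨T1, hT1, hk1, gap1⟩ := exists_gap l1 S1 hc1
  obtain ⟨I0, p0, q0⟩ := core (Tup n1 S1) n0 S0 T0 hT0 gap0 R hrefl hsymm htrans
    (by
      intro b c x y φ hb hc hx hy h1 h2 h3
      exact hom b c x y φ id hb.2 hc.2 hx.2 hy.2 h1 h2 hx.2 hy.2 h3 strictMonoOn_id)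
    (by
      intro b c x y hb hc hx hy
      obtain ⟨ψ, e, hψ⟩ := exists_trans S1 x y hx hy
      have hv : ∀ i, ψ (x i) ∈ S1 := fun i => by
        have := congrFun e i
        simp only [Function.comp] at this
        rw [this]; exact hy.2 i
      have := hom b c x x id ψ hb.2 hc.2 hx.2 hx.2 hb.2 hc.2 hv hv strictMonoOn_id
        (by rwa [Set.union_self])
      rwa [e] at this)
  obtain ⟨I1, p1, q1⟩ := core (Tup n0 S0) n1 S1 T1 hT1 gap1 (fun x b y c => R b x c y)
    (fun x b hx hb => hrefl b x hb hx) (fun x b y c h => hsymm _ _ _ _ h)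
    (fun x b y c z d h h' => htrans _ _ _ _ _ _ h h')
    (by
      intro x y b c ψ hx hy hb hc h1 h2 h3
      exact hom b c x y id ψ hb.2 hc.2 hx.2 hy.2 hb.2 hc.2 h1 h2 strictMonoOn_id h3)
    (by
      intro x y b c hx hy hb hc
      obtain ⟨φ, e, hφ⟩ := exists_trans S0 b c hb hc
      have hv : ∀ i, φ (b i) ∈ S0 := fun i => by
        have := congrFun e i
        simp only [Function.comp] at this
        rw [this]; exact hc.2 i
      have := hom b b x y φ id hb.2 hb.2 hx.2 hy.2 hv hv hx.2 hy.2
        (by rwa [Set.union_self]) strictMonoOn_id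
      rwa [e] at this)
  refine ⟨_, (card_lift T0 (hT0.trans hS0)).trans hk0, _, (card_lift T1 (hT1.trans hS1)).trans hk1,
    I0, I1, ?_⟩
  intro b c hb0 hb1 hc0 hc1
  have tt : ∀ {m n : ℕ} (T : Finset ℕ) (t : {t : Finset (Fin m) // t.card = n}),
      t.1 ⊆ Finset.univ.filter (fun i : Fin m => i.1 ∈ T) → Tup n T (tupOf t) := by
    intro m n T t ht
    refine ⟨tupOf_strictMono t, fun i => ?_⟩
    exact (Finset.mem_filter.1 (ht (Finset.orderEmbOfFin_mem t.1 t.2 i))).2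
  have lift : ∀ {n : ℕ} {T S : Finset ℕ} {b : Fin n → ℕ}, T ⊆ S → Tup n T b → Tup n S b :=
    fun h hb => ⟨hb.1, fun i => h (hb.2 i)⟩
  have B0 := tt T0 b.1 hb0
  have B1 := tt T1 b.2 hb1
  have C0 := tt T0 c.1 hc0
  have C1 := tt T1 c.2 hc1
  rw [← hRE b c]
  constructor
  · intro h
    refine ⟨fun i hi => Fin.ext ?_, fun i hi => Fin.ext ?_⟩
    · exact p0 _ _ _ _ B0 C0 (lift hT1 B1) (lift hT1 C1) h i hi
    · exact p1 _ _ _ _ B1 C1 (lift hT0 B0) (lift hT0 C0) h i hi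
  · rintro ⟨h0, h1⟩
    refine htrans _ _ _ _ _ _
      (q0 _ _ _ (lift hT0 B0) (lift hT0 C0) (lift hT1 B1) (fun i hi => congrArg Fin.val (h0 i hi)))
      (q1 _ _ _ (lift hT1 B1) (lift hT1 C1) (lift hT0 C0) (fun i hi => congrArg Fin.val (h1 i hi)))
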